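/- For a weak composition a and S ∈ meson-highest fillings of shape a, the map sending T ∈ dst⁻¹(S) to its colored weight kwt(T) is a bijection from dst⁻¹(S) to the set of mesonic glides of wt(S); consequently P̄_{wt(S)} = Σ_{T ∈ dst⁻¹(S)} β^{|T|−|S|} x^{wt(T)}. -/

import Mathlib

abbrev Komp : Type := List (ℕ × Bool)

def kex (g : Komp) : ℕ := (g.filter (fun p => p.2)).length

def kval (g : Komp) : List ℕ := g.map Prod.fst

def toKomp (a : List ℕ) : Komp := a.map (fun v => (v, false))

inductive GlideMove : Komp → Komp → Prop
  | m1 (l r : Komp) (p : ℕ) (c : Bool) (hp : 0 < p) :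
      GlideMove (l ++ (0, false) :: (p, c) :: r) (l ++ (p, c) :: (0, false) :: r)
  | m2 (l r : Komp) (p q s : ℕ) (c : Bool) (hq : 0 < q) (hs : 0 < s) (h : q + s = p) :
      GlideMove (l ++ (0, false) :: (p, c) :: r) (l ++ (q, c) :: (s, false) :: r)
  | m3 (l r : Komp) (p q s : ℕ) (c : Bool) (hq : 0 < q) (hs : 0 < s) (h : q + s = p + 1) :
      GlideMove (l ++ (0, false) :: (p, c) :: r) (l ++ (q, c) :: (s, true) :: r)

def IsGlide (a : List ℕ) (g : Komp) : Prop :=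
  Relation.ReflTransGen GlideMove (toKomp a) g

def BlackFirst (seg : Komp) : Prop :=
  ∀ p ∈ (seg.dropWhile fun q => q.1 == 0).head?, p.2 = false

def IsBlock (v : ℕ) (seg : Komp) : Prop :=
  (kval seg).sum = v + kex seg ∧
  (∀ p ∈ seg, p.2 = true → 0 < p.1) ∧
  BlackFirst seg ∧
  (∀ p ∈ seg.getLast?, p.1 ≠ 0)

inductive MesonicGlide : List ℕ → Komp → Prop
  | zeros (k : ℕ) :
      MesonicGlide (List.replicate k 0) (List.replicate k ((0 : ℕ), false))
  | block (z v : ℕ) (hv : 0 < v) (seg : Komp) (a' : List ℕ) (g' : Komp)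
      (hlen : seg.length = z + 1) (hseg : IsBlock v seg)
      (h : MesonicGlide a' g') :
      MesonicGlide (List.replicate z 0 ++ v :: a') (seg ++ g')
def skyline (a : List ℕ) : Finset (ℕ × ℕ) :=
  (Finset.range a.length).biUnion fun i =>
    (Finset.range (a.getD i 0)).image fun j => (i + 1, j + 1)
abbrev SVF : Type := ℕ → ℕ → Finset ℕ

def shapeLen (b : List ℕ) (i : ℕ) : ℕ := b.getD (i - 1) 0

def SBox (b : List ℕ) (i j : ℕ) : Prop :=
  1 ≤ i ∧ i ≤ b.length ∧ 1 ≤ j ∧ j ≤ shapeLen b i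

def anc (F : SVF) (i j : ℕ) : ℕ := (F i j).sup id

noncomputable def infv (F : SVF) (i j : ℕ) : ℕ := sInf (F i j : Set ℕ)

def InvTriple (be al ga : ℕ) : Prop := (ga < al ∧ al ≤ be) ∨ (al ≤ be ∧ be < ga)

def RowOK (b : List ℕ) (F : SVF) (i j v : ℕ) : Prop :=
  (j = 1 ∨ v ≤ infv F i (j - 1)) ∧ (¬ SBox b i (j + 1) ∨ anc F i (j + 1) ≤ v)

def SVSSF (b : List ℕ) (F : SVF) : Prop :=
  (∀ i j, (F i j).Nonempty ↔ SBox b i j) ∧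
  (∀ i j v, v ∈ F i j → 0 < v) ∧
  (∀ j i i', i ≠ i' → ∀ v, v ∈ F i j → v ∉ F i' j) ∧
  (∀ i j, SBox b i j → SBox b i (j + 1) → anc F i (j + 1) ≤ infv F i j) ∧
  (∀ i i' j, i < i' → SBox b i j → SBox b i (j + 1) → SBox b i' (j + 1) →
      shapeLen b i' ≤ shapeLen b i → InvTriple (anc F i j) (anc F i (j + 1)) (anc F i' (j + 1))) ∧
  (∀ i i' j, i < i' → SBox b i' j → SBox b i' (j + 1) → SBox b i j →
      shapeLen b i < shapeLen b i' → InvTriple (anc F i' j) (anc F i' (j + 1)) (anc F i j)) ∧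
  (∀ i j v, SBox b i j → v ∈ F i j → v ≠ anc F i j →
      ∀ i', SBox b i' j → anc F i' j < anc F i j → v < anc F i' j → ¬ RowOK b F i' j v)

def LASSF (b : List ℕ) (F : SVF) : Prop :=
  SVSSF b F ∧ ∀ i, SBox b i 1 → anc F i 1 = i

def wtF (b : List ℕ) (F : SVF) (v : ℕ) : ℕ :=
  ((skyline b).filter fun p => v ∈ F p.1 p.2).card

def sizeF (b : List ℕ) (F : SVF) : ℕ := ∑ p ∈ skyline b, (F p.1 p.2).card
def Appears (F : SVF) (v : ℕ) : Prop := ∃ i j, v ∈ F i j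

noncomputable def upVal (F : SVF) (v : ℕ) : ℕ := sInf {k | v < k ∧ Appears F k}

def HighestAt (F : SVF) (v : ℕ) : Prop :=
  ∃ i j, v ∈ F i j ∧ (∀ i' j', v ∈ F i' j' → j ≤ j') ∧
    ((j = 1 ∧ anc F i 1 = v) ∨
      ∃ i' j', upVal F v ∈ F i' j' ∧ j ≤ j' ∧ (i', j') ≠ (i, j))

def MesonHighest (F : SVF) : Prop := ∀ v, Appears F v → HighestAt F v

def replaceUp (F : SVF) (v : ℕ) : SVF := fun i j =>
  if v ∈ F i j then insert (v + 1) ((F i j).erase v) else F i j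

def DStep (F F' : SVF) : Prop :=
  ∃ v, Appears F v ∧ ¬ HighestAt F v ∧
    (∀ w, Appears F w → ¬ HighestAt F w → v ≤ w) ∧ F' = replaceUp F v
noncomputable def xmonoPos (w : List ℕ) : MvPolynomial ℕ (Polynomial ℤ) :=
  ∏ i ∈ Finset.range w.length, MvPolynomial.X (i + 1) ^ w.getD i 0

noncomputable def glidePoly (a : List ℕ) : MvPolynomial ℕ (Polynomial ℤ) :=
  ∑ᶠ g ∈ {g : Komp | IsGlide a g},
    MvPolynomial.C (Polynomial.X ^ kex g) * xmonoPos (kval g)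

noncomputable def kaonPoly (b : List ℕ) : MvPolynomial ℕ (Polynomial ℤ) :=
  ∑ᶠ g ∈ {g : Komp | MesonicGlide b g},
    MvPolynomial.C (Polynomial.X ^ kex g) * xmonoPos (kval g)

noncomputable def vmono (w : ℕ → ℕ) : MvPolynomial ℕ (Polynomial ℤ) :=
  ∏ᶠ v, MvPolynomial.X v ^ w v


namespace K15

lemma le_anc {F : SVF} {i j v : ℕ} (h : v ∈ F i j) : v ≤ anc F i j :=
  Finset.le_sup (f := id) h

lemma anc_mem {F : SVF} {i j : ℕ} (h : (F i j).Nonempty) : anc F i j ∈ F i j := by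
  obtain ⟨x, hx, he⟩ := Finset.exists_mem_eq_sup (F i j) h id
  unfold anc
  rw [he]; exact hx

lemma infv_le {F : SVF} {i j v : ℕ} (h : v ∈ F i j) : infv F i j ≤ v :=
  Nat.sInf_le (by simpa using h)

lemma infv_mem {F : SVF} {i j : ℕ} (h : (F i j).Nonempty) : infv F i j ∈ F i j := by
  have := Nat.sInf_mem (s := (F i j : Set ℕ)) (by simpa using h)
  simpa [infv] using this

lemma anc_eq {F : SVF} {i j v : ℕ} (h : v ∈ F i j) (h2 : ∀ w ∈ F i j, w ≤ v) : anc F i j = v :=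
  le_antisymm (h2 _ (anc_mem ⟨v, h⟩)) (le_anc h)

lemma infv_eq {F : SVF} {i j v : ℕ} (h : v ∈ F i j) (h2 : ∀ w ∈ F i j, v ≤ w) : infv F i j = v :=
  le_antisymm (infv_le h) (h2 _ (infv_mem ⟨v, h⟩))

lemma S_le {a : List ℕ} {S : SVF} (hS : LASSF a S) {i j v : ℕ} (h : v ∈ S i j) : v ≤ a.length := by
  obtain ⟨⟨hne, -, -, hrow, -⟩, h1⟩ := hS
  have key : ∀ j, SBox a i (j+1) → anc S i (j+1) ≤ i := by
    intro j
    induction j with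
    | zero => intro hb; exact (h1 i hb).le
    | succ j ih =>
      intro hb
      have hb' : SBox a i (j+1) := ⟨hb.1, hb.2.1, by omega, by have := hb.2.2.2; omega⟩
      refine (hrow i (j+1) hb' hb).trans ((infv_le (anc_mem ((hne _ _).2 hb'))).trans (ih hb'))
  have hb := (hne i j).1 ⟨v, h⟩
  obtain ⟨j, rfl⟩ : ∃ k, j = k + 1 := ⟨j - 1, by have := hb.2.2.1; omega⟩
  exact (le_anc h).trans ((key j hb).trans hb.2.1)

def PP (n : ℕ) (S : SVF) (s : ℕ) : Prop := s = 0 ∨ Appears S s ∨ n < s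

noncomputable def ph (n : ℕ) (S : SVF) (u : ℕ) : ℕ := sInf {s | u ≤ s ∧ PP n S s}

lemma ph_spec (n : ℕ) (S : SVF) (u : ℕ) : u ≤ ph n S u ∧ PP n S (ph n S u) :=
  Nat.sInf_mem (s := {s | u ≤ s ∧ PP n S s}) ⟨u + n + 1, by omega, Or.inr (Or.inr (by omega))⟩

lemma le_ph (n : ℕ) (S : SVF) (u : ℕ) : u ≤ ph n S u := (ph_spec n S u).1

lemma ph_le {n : ℕ} {S : SVF} {u s : ℕ} (h : u ≤ s) (hp : PP n S s) : ph n S u ≤ s :=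
  Nat.sInf_le ⟨h, hp⟩

lemma ph_fix {n : ℕ} {S : SVF} {u : ℕ} (hp : PP n S u) : ph n S u = u :=
  le_antisymm (ph_le le_rfl hp) (le_ph _ _ _)

lemma ph_mono {n : ℕ} {S : SVF} {u w : ℕ} (h : u ≤ w) : ph n S u ≤ ph n S w :=
  ph_le (h.trans (le_ph _ _ _)) (ph_spec _ _ _).2

lemma ph_lt {n : ℕ} {S : SVF} {u w : ℕ} (h : ph n S u < ph n S w) : u < w := by
  by_contra hc
  have := ph_mono (n := n) (S := S) (not_lt.1 hc)
  omega

lemma ph_mid {n : ℕ} {S : SVF} {u w : ℕ} (h : u ≤ w) (h2 : w ≤ ph n S u) :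
    ph n S w = ph n S u :=
  le_antisymm (ph_le h2 (ph_spec _ _ _).2) (ph_mono h)

lemma ph_succ {n : ℕ} {S : SVF} {u : ℕ} (hp : ¬ PP n S u) : ph n S (u+1) = ph n S u := by
  apply ph_mid (by omega)
  have h1 := le_ph n S u
  rcases h1.lt_or_eq with h | h
  · exact h
  · exact absurd (h ▸ (ph_spec n S u).2) hp

/-- The explicit description of the fibre. -/
structure RR (n : ℕ) (T S : SVF) : Prop where
  img : ∀ i j u, u ∈ T i j → ph n S u ∈ S i j
  sur : ∀ i j s, s ∈ S i j → ∃ u ∈ T i j, ph n S u = s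
  ord : ∀ u u' i j i' j', u < u' → ph n S u = ph n S u' → u ∈ T i j → u' ∈ T i' j' →
    j' < j ∨ (i' = i ∧ j' = j)
  app : ∀ s, Appears S s → Appears T s

lemma RR.anc {n : ℕ} {T S : SVF} (h : RR n T S) {i j : ℕ} (hne : (T i j).Nonempty) :
    anc S i j = ph n S (anc T i j) := by
  apply anc_eq (h.img _ _ _ (anc_mem hne))
  intro w hw
  obtain ⟨u, hu, rfl⟩ := h.sur _ _ _ hw
  exact ph_mono (le_anc hu)

lemma RR.infv {n : ℕ} {T S : SVF} (h : RR n T S) {i j : ℕ} (hne : (T i j).Nonempty) :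
    infv S i j = ph n S (infv T i j) := by
  apply infv_eq (h.img _ _ _ (infv_mem hne))
  intro w hw
  obtain ⟨u, hu, rfl⟩ := h.sur _ _ _ hw
  exact ph_mono (infv_le hu)

lemma RR.lassf {a : List ℕ} {T S : SVF} (hS : LASSF a S) (h : RR a.length T S) : LASSF a T := by
  obtain ⟨⟨hne, hpos, hcol, hrow, hA, hB, hfree⟩, h1⟩ := hS
  have hne' : ∀ i j, (T i j).Nonempty ↔ SBox a i j := by
    intro i j
    rw [← hne]
    constructor
    · rintro ⟨u, hu⟩; exact ⟨_, h.img _ _ _ hu⟩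
    · rintro ⟨s, hs⟩; obtain ⟨u, hu, -⟩ := h.sur _ _ _ hs; exact ⟨u, hu⟩
  have hanc : ∀ i j, SBox a i j → _root_.anc S i j = ph a.length S (_root_.anc T i j) :=
    fun i j hb => h.anc ((hne' i j).2 hb)
  have hinf : ∀ i j, SBox a i j → _root_.infv S i j = ph a.length S (_root_.infv T i j) :=
    fun i j hb => h.infv ((hne' i j).2 hb)
  have hmem : ∀ i j, SBox a i j → _root_.anc T i j ∈ T i j := fun i j hb => anc_mem ((hne' i j).2 hb)
  have hmem' : ∀ i j, SBox a i j → _root_.infv T i j ∈ T i j :=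
    fun i j hb => infv_mem ((hne' i j).2 hb)
  -- weak inequality transfer from column j to column j+1
  have hweak : ∀ i j i' x y, x ∈ T i (j+1) → y ∈ T i' j → ph a.length S x ≤ ph a.length S y →
      x ≤ y := by
    intro i j i' x y hx hy hxy
    rcases hxy.lt_or_eq with hlt | heq
    · exact (ph_lt hlt).le
    · by_contra hc
      rcases h.ord y x i' j i (j+1) (by omega) heq.symm hy hx with h' | h' <;> omega
  have hcol' : ∀ j i i', i ≠ i' → ∀ v, v ∈ T i j → v ∉ T i' j := fun j i i' hi v hv hv' =>
    hcol j i i' hi _ (h.img _ _ _ hv) (h.img _ _ _ hv')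
  refine ⟨⟨hne', ?_, hcol', ?_, ?_, ?_, ?_⟩, ?_⟩
  · intro i j v hv
    rcases Nat.eq_zero_or_pos v with rfl | hp
    · have := hpos _ _ _ (h.img _ _ _ hv)
      rw [ph_fix (Or.inl rfl)] at this
      omega
    · exact hp
  · intro i j hb hb'
    have := hrow i j hb hb'
    rw [hanc _ _ hb', hinf _ _ hb] at this
    exact hweak i j i _ _ (hmem _ _ hb') (hmem' _ _ hb) this
  · intro i i' j hi hb hb' hb'' hl
    have := hA i i' j hi hb hb' hb'' hl
    rw [hanc _ _ hb, hanc _ _ hb', hanc _ _ hb''] at this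
    rcases this with ⟨h2, h3⟩ | ⟨h2, h3⟩
    · exact Or.inl ⟨ph_lt h2, hweak _ _ _ _ _ (hmem _ _ hb') (hmem _ _ hb) h3⟩
    · exact Or.inr ⟨hweak _ _ _ _ _ (hmem _ _ hb') (hmem _ _ hb) h2, ph_lt h3⟩
  · intro i i' j hi hb hb' hb'' hl
    have := hB i i' j hi hb hb' hb'' hl
    rw [hanc _ _ hb, hanc _ _ hb', hanc _ _ hb''] at this
    rcases this with ⟨h2, h3⟩ | ⟨h2, h3⟩
    · exact Or.inl ⟨ph_lt h2, hweak _ _ _ _ _ (hmem _ _ hb') (hmem _ _ hb) h3⟩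
    · exact Or.inr ⟨hweak _ _ _ _ _ (hmem _ _ hb') (hmem _ _ hb) h2, ph_lt h3⟩
  · intro i j v hb hv hva i' hb' hlt hv' hrok
    have hii : i ≠ i' := by rintro rfl; omega
    have n1 : ph a.length S v < ph a.length S (_root_.anc T i' j) := by
      refine lt_of_le_of_ne (ph_mono hv'.le) fun he => ?_
      exact hcol j i i' hii _ (h.img _ _ _ hv) (he ▸ h.img _ _ _ (hmem _ _ hb'))
    have n2 : ph a.length S (_root_.anc T i' j) < ph a.length S (_root_.anc T i j) := by
      refine lt_of_le_of_ne (ph_mono hlt.le) fun he => ?_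
      exact hcol j i i' hii _ (h.img _ _ _ (hmem _ _ hb)) (he ▸ h.img _ _ _ (hmem _ _ hb'))
    have := hfree i j _ hb (h.img _ _ _ hv) (by rw [hanc _ _ hb]; omega) i' hb'
      (by rwa [hanc _ _ hb, hanc _ _ hb']) (by rwa [hanc _ _ hb'])
    apply this
    refine ⟨?_, ?_⟩
    · rcases hrok.1 with h' | h'
      · exact Or.inl h'
      · by_cases hj : j = 1
        · exact Or.inl hj
        · right
          have hbb : SBox a i' (j-1) := ⟨hb'.1, hb'.2.1, by have := hb'.2.2.1; omega,
            by have := hb'.2.2.2; omega⟩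
          rw [hinf _ _ hbb]
          exact ph_mono h'
    · rcases hrok.2 with h' | h'
      · exact Or.inl h'
      · by_cases hbb : SBox a i' (j+1)
        · right
          rw [hanc _ _ hbb]
          exact ph_mono h'
        · exact Or.inl hbb
  · intro i hb
    have e1 := h1 i hb
    rw [hanc _ _ hb] at e1
    have hiS : i ∈ S i 1 := by
      have := h.img _ _ _ (hmem _ _ hb); rwa [e1] at this
    obtain ⟨i2, j2, hi2⟩ := h.app i ⟨_, _, hiS⟩
    have hle := le_ph a.length S (_root_.anc T i 1)
    rw [e1] at hle
    rcases hle.lt_or_eq with hlt | heq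
    · have hj2 := ((hne' _ _).1 ⟨_, hi2⟩).2.2.1
      rcases h.ord _ _ _ _ _ _ hlt (by rw [e1, ph_fix (Or.inr (Or.inl ⟨_, _, hiS⟩))])
        (hmem _ _ hb) hi2 with h' | ⟨rfl, rfl⟩
      · omega
      · exact le_antisymm hle (le_anc hi2)
    · exact heq

lemma upVal_spec {F : SVF} {v w : ℕ} (hw : Appears F w) (h : v < w) :
    v < upVal F v ∧ Appears F (upVal F v) ∧ upVal F v ≤ w := by
  have := Nat.sInf_mem (s := {k | v < k ∧ Appears F k}) ⟨w, h, hw⟩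
  exact ⟨this.1, this.2, Nat.sInf_le ⟨h, hw⟩⟩

lemma upVal_app {F : SVF} {v i j : ℕ} (hpos : ∀ i j v, v ∈ F i j → 0 < v)
    (h : upVal F v ∈ F i j) : v < upVal F v := by
  by_contra hc
  have : {k | v < k ∧ Appears F k} = ∅ := by
    by_contra hne
    obtain ⟨w, hw⟩ := Set.nonempty_iff_ne_empty.2 hne
    exact hc (upVal_spec hw.2 hw.1).1
  have h0 : upVal F v = 0 := by unfold upVal; rw [this]; simp
  have := hpos _ _ _ h
  omega

lemma RR.highest {a : List ℕ} {T S : SVF} (hS : LASSF a S) (hm : MesonHighest S)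
    (h : RR a.length T S) {u : ℕ} (hu : Appears S u) : HighestAt T u := by
  have hT := h.lassf hS
  have hphu : ph a.length S u = u := ph_fix (Or.inr (Or.inl hu))
  obtain ⟨i, j, hij, hleft, hor⟩ := hm u hu
  have hmem : u ∈ T i j := by
    obtain ⟨u0, hu0, he⟩ := h.sur _ _ _ hij
    have hle := le_ph a.length S u0
    rw [he] at hle
    rcases hle.lt_or_eq with hlt | rfl
    · obtain ⟨i2, j2, h2⟩ := h.app u hu
      have h3 := h.img _ _ _ h2
      rw [hphu] at h3
      have := hleft _ _ h3
      rcases h.ord _ _ _ _ _ _ hlt (by rw [he, hphu]) hu0 h2 with h' | ⟨rfl, rfl⟩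
      · omega
      · exact h2
    · exact hu0
  refine ⟨i, j, hmem, ?_, ?_⟩
  · intro i' j' h'
    have := h.img _ _ _ h'
    rw [hphu] at this
    exact hleft _ _ this
  · rcases hor with ⟨rfl, he⟩ | ⟨i', j', hup, hjj, hne⟩
    · left
      refine ⟨rfl, ?_⟩
      have hb := (hS.1.1 i 1).1 ⟨_, hij⟩
      rw [hS.2 i hb] at he
      rw [hT.2 i hb, he]
    · right
      have hupS : u < upVal S u := upVal_app hS.1.2.1 hup
      obtain ⟨k', hk', hek⟩ := h.sur _ _ _ hup
      have hk'u : u < k' := ph_lt (n := a.length) (S := S) (by rw [hphu, hek]; exact hupS)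
      obtain ⟨g1, g2, g3⟩ := upVal_spec ⟨_, _, hk'⟩ hk'u
      obtain ⟨i2, j2, h2⟩ := g2
      have hphk : ph a.length S (upVal T u) = upVal S u := by
        apply le_antisymm
        · rw [← hek]; exact ph_mono g3
        · exact (upVal_spec ⟨_, _, h.img _ _ _ h2⟩ (lt_of_lt_of_le g1 (le_ph _ _ _))).2.2
      rcases g3.lt_or_eq with hlt | heq
      · rcases h.ord _ _ _ _ _ _ hlt (by rw [hphk, hek]) h2 hk' with h' | ⟨rfl, rfl⟩
        · refine ⟨i2, j2, h2, by omega, ?_⟩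
          intro hc
          simp only [Prod.mk.injEq] at hc
          omega
        · exact ⟨_, _, h2, hjj, hne⟩
      · exact ⟨i', j', heq ▸ hk', hjj, hne⟩

lemma RR.not_highest {a : List ℕ} {T S : SVF} (hS : LASSF a S)
    (h : RR a.length T S) {u : ℕ} (huT : Appears T u) (hu : ¬ Appears S u) : ¬ HighestAt T u := by
  have hT := h.lassf hS
  rintro ⟨i, j, hij, hleft, hor⟩
  rcases hor with ⟨rfl, he⟩ | ⟨i', j', hup, hjj, hne⟩
  · have hb := (hT.1.1 i 1).1 ⟨_, hij⟩
    rw [hT.2 i hb] at he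
    have e2 := hS.2 i hb
    have := anc_mem ((hS.1.1 i 1).2 hb)
    rw [e2, he] at this
    exact hu ⟨_, _, this⟩
  · have hph := h.img _ _ _ hij
    have hlt : u < ph a.length S u := by
      refine lt_of_le_of_ne (le_ph _ _ _) fun he => hu ?_
      rw [he]; exact ⟨_, _, hph⟩
    obtain ⟨g1, g2, g3⟩ := upVal_spec (h.app _ ⟨_, _, hph⟩) hlt
    rcases h.ord _ _ _ _ _ _ g1 (ph_mid g1.le g3).symm hij hup with h' | ⟨rfl, rfl⟩
    · omega
    · exact hne rfl

def psi (v w : ℕ) : ℕ := if w = v then v + 1 else w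

lemma mem_replaceUp {F : SVF} {v i j w : ℕ} :
    w ∈ replaceUp F v i j ↔ ∃ x ∈ F i j, psi v x = w := by
  unfold replaceUp psi
  constructor
  · split_ifs with h
    · intro hw
      simp only [Finset.mem_insert, Finset.mem_erase] at hw
      rcases hw with rfl | ⟨h1, h2⟩
      · exact ⟨v, h, by simp⟩
      · exact ⟨w, h2, by simp [h1]⟩
    · intro hw
      exact ⟨w, hw, by rw [if_neg]; rintro rfl; exact h hw⟩
  · rintro ⟨x, hx, rfl⟩
    by_cases h1 : x = v
    · subst h1; simp [hx]
    · by_cases h2 : v ∈ F i j <;> simp [h1, h2, hx]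

lemma RR.refl {n : ℕ} {S : SVF} : RR n S S := by
  have hf : ∀ i j u, u ∈ S i j → ph n S u = u := fun i j u hu => ph_fix (Or.inr (Or.inl ⟨i, j, hu⟩))
  refine ⟨fun i j u hu => by rwa [hf _ _ _ hu], fun i j s hs => ⟨s, hs, hf _ _ _ hs⟩, ?_, fun s h => h⟩
  intro u u' i j i' j' hlt he h1 h2
  rw [hf _ _ _ h1, hf _ _ _ h2] at he
  omega

lemma ph_psi {n : ℕ} {S : SVF} {v : ℕ} (hp : ¬ PP n S v) (w : ℕ) :
    ph n S (psi v w) = ph n S w := by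
  unfold psi
  split_ifs with h
  · rw [h, ph_succ hp]
  · rfl

lemma psi_lt {v x y : ℕ} (h : psi v x < psi v y) : x < y := by
  unfold psi at h; split_ifs at h <;> omega

lemma RR.step {n : ℕ} {T S : SVF} (h : RR n T S) {v : ℕ} (hp : ¬ PP n S v) :
    RR n (replaceUp T v) S := by
  refine ⟨?_, ?_, ?_, ?_⟩
  · intro i j u hu
    obtain ⟨x, hx, rfl⟩ := mem_replaceUp.1 hu
    rw [ph_psi hp]; exact h.img _ _ _ hx
  · intro i j s hs
    obtain ⟨u, hu, rfl⟩ := h.sur _ _ _ hs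
    exact ⟨psi v u, mem_replaceUp.2 ⟨u, hu, rfl⟩, ph_psi hp u⟩
  · intro u u' i j i' j' hlt he h1 h2
    obtain ⟨x, hx, rfl⟩ := mem_replaceUp.1 h1
    obtain ⟨y, hy, rfl⟩ := mem_replaceUp.1 h2
    rw [ph_psi hp, ph_psi hp] at he
    exact h.ord _ _ _ _ _ _ (psi_lt hlt) he hx hy
  · intro s hs
    obtain ⟨i, j, hij⟩ := h.app s hs
    refine ⟨i, j, mem_replaceUp.2 ⟨s, hij, ?_⟩⟩
    unfold psi
    rw [if_neg]
    rintro rfl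
    exact hp (Or.inr (Or.inl hs))

lemma RR.chain {a : List ℕ} {S : SVF} (hS : LASSF a S) (hm : MesonHighest S) :
    ∀ (m k : ℕ) (T : SVF), a.length + 1 ≤ k + m → RR a.length T S →
      (∀ u, Appears T u → u < k → Appears S u) → Relation.ReflTransGen DStep T S := by
  intro m
  induction m with
  | zero =>
    intro k T hk h hlow
    have : T = S := by
      have hap : ∀ u, Appears T u → ph a.length S u = u := by
        intro u hu
        refine ph_fix (Or.inr (Or.inl (hlow u hu ?_)))
        obtain ⟨i, j, hij⟩ := hu
        have := S_le hS (h.img _ _ _ hij)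
        have := le_ph a.length S u
        omega
      funext i j
      ext u
      constructor
      · intro hu
        have := h.img _ _ _ hu
        rwa [hap u ⟨_, _, hu⟩] at this
      · intro hu
        obtain ⟨w, hw, he⟩ := h.sur _ _ _ hu
        rw [hap w ⟨_, _, hw⟩] at he
        rwa [← he]
    rw [this]
  | succ m ih =>
    intro k T hk h hlow
    by_cases hc : Appears T k ∧ ¬ Appears S k
    · obtain ⟨hkT, hkS⟩ := hc
      have hT := h.lassf hS
      have hp : ¬ PP a.length S k := by
        obtain ⟨i, j, hij⟩ := hkT
        rintro (h' | h' | h')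
        · have := hT.1.2.1 _ _ _ hij; omega
        · exact hkS h'
        · have := S_le hS (h.img _ _ _ hij)
          have := le_ph a.length S k
          omega
      refine Relation.ReflTransGen.head (b := replaceUp T k) ?_ ?_
      · refine ⟨k, hkT, h.not_highest hS hkT hkS, ?_, rfl⟩
        intro w hw hwn
        by_contra hc
        exact hwn (h.highest hS hm (hlow w hw (by omega)))
      · apply ih (k+1) _ (by omega) (h.step hp)
        rintro u ⟨i, j, hu⟩ huk
        obtain ⟨x, hx, rfl⟩ := mem_replaceUp.1 hu
        unfold psi at huk ⊢
        split_ifs at huk ⊢ with hxk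
        · omega
        · exact hlow x ⟨_, _, hx⟩ (by omega)
    · apply ih (k+1) T (by omega) h
      intro u hu huk
      rcases (Nat.lt_succ_iff.1 huk).lt_or_eq with h' | rfl
      · exact hlow u hu h'
      · by_contra h'; exact hc ⟨hu, h'⟩

lemma RR.of_step {a : List ℕ} {T S : SVF} (hS : LASSF a S) (hm : MesonHighest S) {v : ℕ}
    (hpos : ∀ i j v, v ∈ T i j → 0 < v)
    (hvT : Appears T v) (hnh : ¬ HighestAt T v)
    (h : RR a.length (replaceUp T v) S) : RR a.length T S := by
  have hT' := h.lassf hS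
  have hvT' : ¬ Appears (replaceUp T v) v := by
    rintro ⟨i, j, hij⟩
    obtain ⟨x, hx, he⟩ := mem_replaceUp.1 hij
    unfold psi at he
    split_ifs at he <;> omega
  have hvS : ¬ Appears S v := fun hc => hvT' (h.app v hc)
  have hin : ∀ i j x, x ∈ T i j → psi v x ∈ replaceUp T v i j :=
    fun i j x hx => mem_replaceUp.2 ⟨x, hx, rfl⟩
  have hp : ¬ PP a.length S v := by
    obtain ⟨i, j, hij⟩ := hvT
    rintro (h' | h' | h')
    · have := hpos _ _ _ hij; omega
    · exact hvS h'
    · have h2 := S_le hS (h.img _ _ _ (hin _ _ _ hij))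
      have := le_ph a.length S (psi v v)
      simp [psi] at h2 this
      omega
  have hcolT : ∀ i i' j x, x ∈ T i j → x ∈ T i' j → i = i' := by
    intro i i' j x h1 h2
    by_contra hc
    exact hT'.1.2.2.1 j i i' hc _ (hin _ _ _ h1) (hin _ _ _ h2)
  refine ⟨?_, ?_, ?_, ?_⟩
  · intro i j u hu
    have := h.img _ _ _ (hin _ _ _ hu)
    rwa [ph_psi hp] at this
  · intro i j s hs
    obtain ⟨u, hu, rfl⟩ := h.sur _ _ _ hs
    obtain ⟨x, hx, rfl⟩ := mem_replaceUp.1 hu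
    exact ⟨x, hx, (ph_psi hp x).symm⟩
  · intro u u' i j i' j' hlt he h1 h2
    by_cases hc : u = v ∧ u' = v + 1
    · obtain ⟨rfl, rfl⟩ := hc
      have hup : upVal T u = u + 1 := by
        have := upVal_spec ⟨_, _, h2⟩ hlt
        omega
      -- leftmost
      classical
      have hex : ∃ j, ∃ i, u ∈ T i j := ⟨j, i, h1⟩
      obtain ⟨i0, h0⟩ := Nat.find_spec hex
      have hmin : ∀ i' j', u ∈ T i' j' → Nat.find hex ≤ j' := fun i' j' h' => Nat.find_min' hex ⟨i', h'⟩
      have hj := hmin _ _ h1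
      by_contra hcon
      apply hnh
      refine ⟨i0, Nat.find hex, h0, hmin, Or.inr ⟨i', j', hup ▸ h2, by omega, ?_⟩⟩
      intro hpe
      simp only [Prod.mk.injEq] at hpe
      apply hcon
      rcases hj.lt_or_eq with h' | h'
      · left; omega
      · right
        rw [h'] at h0
        exact ⟨hpe.1.trans (hcolT _ _ _ _ h0 h1), by omega⟩
    · apply h.ord (psi v u) (psi v u') i j i' j' _ _ (hin _ _ _ h1) (hin _ _ _ h2)
      · unfold psi; split_ifs <;> omega
      · rw [ph_psi hp, ph_psi hp, he]
  · intro s hs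
    by_cases hsv : s = v + 1
    · subst hsv
      by_contra hnT
      have hiff : ∀ i j, v + 1 ∈ replaceUp T v i j ↔ v ∈ T i j := by
        intro i j
        rw [mem_replaceUp]
        constructor
        · rintro ⟨x, hx, he⟩
          unfold psi at he
          split_ifs at he with hxv
          · rwa [← hxv]
          · exact absurd ⟨_, _, he ▸ hx⟩ hnT
        · intro hv; exact ⟨v, hv, by simp [psi]⟩
      have hup : upVal (replaceUp T v) (v+1) = upVal T v := by
        unfold upVal
        congr 1
        ext k
        simp only [Set.mem_setOf_eq]
        constructor
        · rintro ⟨hk, i, j, hij⟩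
          obtain ⟨x, hx, rfl⟩ := mem_replaceUp.1 hij
          unfold psi at hk ⊢
          split_ifs at hk ⊢ with hxv
          · omega
          · exact ⟨by omega, _, _, hx⟩
        · rintro ⟨hk, i, j, hij⟩
          have : k ≠ v + 1 := by rintro rfl; exact hnT ⟨_, _, hij⟩
          refine ⟨by omega, i, j, mem_replaceUp.2 ⟨k, hij, ?_⟩⟩
          unfold psi; rw [if_neg (by omega)]
      obtain ⟨i, j, hij, hleft, hor⟩ := h.highest hS hm hs
      apply hnh
      refine ⟨i, j, (hiff _ _).1 hij, fun i' j' h' => hleft _ _ ((hiff _ _).2 h'), ?_⟩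
      rcases hor with ⟨rfl, he⟩ | ⟨i', j', hu, hjj, hne⟩
      · left
        refine ⟨rfl, anc_eq ((hiff _ _).1 hij) ?_⟩
        intro w hw
        have := le_anc (hin _ _ _ hw)
        rw [he] at this
        have hwv : w ≠ v + 1 := by rintro rfl; exact hnT ⟨_, _, hw⟩
        unfold psi at this
        split_ifs at this <;> omega
      · right
        rw [hup] at hu
        obtain ⟨x, hx, he⟩ := mem_replaceUp.1 hu
        refine ⟨i', j', ?_, hjj, hne⟩
        have hvlt : v + 1 < upVal T v := by
          rw [← hup]; rw [← hup] at hu; exact upVal_app hT'.1.2.1 hu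
        unfold psi at he
        split_ifs at he
        · omega
        · rwa [← he]
    · obtain ⟨i, j, hij⟩ := h.app s hs
      obtain ⟨x, hx, he⟩ := mem_replaceUp.1 hij
      unfold psi at he
      split_ifs at he
      · omega
      · exact ⟨i, j, he ▸ hx⟩

lemma RR.iff {a : List ℕ} {S : SVF} (hS : LASSF a S) (hm : MesonHighest S) (T : SVF) :
    (LASSF a T ∧ Relation.ReflTransGen DStep T S) ↔ RR a.length T S := by
  constructor
  · rintro ⟨hT, hch⟩
    have : (∀ i j v, v ∈ T i j → 0 < v) → RR a.length T S := by
      clear hT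
      induction hch using Relation.ReflTransGen.head_induction_on with
      | refl => intro _; exact RR.refl
      | head hst _ ih =>
        intro hpos
        obtain ⟨v, h1, h2, -, rfl⟩ := hst
        refine RR.of_step hS hm hpos h1 h2 (ih ?_)
        intro i j w hw
        obtain ⟨x, hx, rfl⟩ := mem_replaceUp.1 hw
        have := hpos _ _ _ hx
        unfold psi; split_ifs <;> omega
    exact this hT.1.2.1
  · intro h
    exact ⟨h.lassf hS, RR.chain hS hm (a.length + 1) 0 T (by omega) h (fun u _ hu => by omega)⟩

def bn (b : Bool) : ℕ := if b then 1 else 0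

def Stp (acc v : ℕ) (p : ℕ × Bool) (acc' : ℕ) : Prop :=
  (p.2 = true → 0 < p.1 ∧ 0 < acc) ∧
  (v = 0 → acc' + bn p.2 = acc + p.1) ∧
  (0 < v → acc' = 0 ∧ 0 < p.1 ∧ acc + p.1 = v + bn p.2)

inductive MGr : ℕ → List ℕ → Komp → Prop
  | nil : MGr 0 [] []
  | cons (acc v : ℕ) (p : ℕ × Bool) (acc' : ℕ) (c : List ℕ) (g : Komp)
      (hs : Stp acc v p acc') (h : MGr acc' c g) : MGr acc (v :: c) (p :: g)

lemma kex_cons (p : ℕ × Bool) (g : Komp) : kex (p :: g) = bn p.2 + kex g := by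
  rcases p with ⟨x, _ | _⟩ <;> simp [kex, bn]; omega

lemma MGr.sum {acc : ℕ} {c : List ℕ} {g : Komp} (h : MGr acc c g) :
    (kval g).sum + acc = c.sum + kex g := by
  induction h with
  | nil => simp [kval, kex]
  | cons acc v p acc' c g hs h ih =>
    rw [kex_cons]
    simp only [kval, List.map_cons, List.sum_cons] at ih ⊢
    rcases Nat.eq_zero_or_pos v with h0 | h0
    · have := hs.2.1 h0; omega
    · have := hs.2.2 h0; omega

lemma blackFirst_cons (p : ℕ × Bool) (seg : Komp) :
    BlackFirst (p :: seg) ↔ (p.1 = 0 → BlackFirst seg) ∧ (p.1 ≠ 0 → p.2 = false) := by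
  unfold BlackFirst
  by_cases h : p.1 = 0
  · simp [h]
  · simp [h]

lemma mgr_zeros (k : ℕ) : MGr 0 (List.replicate k 0) (List.replicate k ((0 : ℕ), false)) := by
  induction k with
  | zero => exact MGr.nil
  | succ k ih =>
    rw [List.replicate_succ, List.replicate_succ]
    exact MGr.cons 0 0 (0, false) 0 _ _ (by simp [Stp, bn]) ih

lemma mgr_block (v : ℕ) (hv : 0 < v) (a' : List ℕ) (g' : Komp) (h : MGr 0 a' g') :
    ∀ (z acc : ℕ) (seg : Komp), seg.length = z + 1 →
    (kval seg).sum + acc = v + kex seg →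
    (∀ p ∈ seg, p.2 = true → 0 < p.1) → (acc = 0 → BlackFirst seg) →
    (∀ p ∈ seg.getLast?, p.1 ≠ 0) →
    MGr acc (List.replicate z 0 ++ v :: a') (seg ++ g') := by
  intro z
  induction z with
  | zero =>
    intro acc seg hl hsum hred hbf hlast
    obtain ⟨p, rfl⟩ := List.length_eq_one_iff.1 hl
    simp only [List.replicate_zero, List.nil_append, List.singleton_append]
    refine MGr.cons acc v p 0 _ _ ⟨?_, by omega, ?_⟩ h
    · intro hp
      refine ⟨hred p (by simp) hp, ?_⟩
      by_contra hc
      have := (blackFirst_cons p []).1 (hbf (by omega))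
      have h2 := this.2 (by have := hred p (by simp) hp; omega)
      rw [hp] at h2; cases h2
    · intro _
      have h1 := hlast p (by simp)
      rw [kex_cons] at hsum
      simp [kval, kex] at hsum
      exact ⟨rfl, by omega, by omega⟩
  | succ z ih =>
    intro acc seg hl hsum hred hbf hlast
    rcases seg with _ | ⟨p, seg⟩
    · simp at hl
    have hlen : seg.length = z + 1 := by simpa using hl
    have hps : p.2 = true → 0 < p.1 ∧ 0 < acc := by
      intro hp
      refine ⟨hred p (by simp) hp, ?_⟩
      by_contra hc
      have := (blackFirst_cons p seg).1 (hbf (by omega))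
      have h2 := this.2 (by have := hred p (by simp) hp; omega)
      rw [hp] at h2; cases h2
    have hb : bn p.2 ≤ p.1 ∧ bn p.2 ≤ acc := by
      by_cases hp : p.2 = true
      · have := hps hp; simp [bn, hp]; omega
      · simp [bn, hp]
    rw [List.replicate_succ, List.cons_append, List.cons_append]
    rw [kex_cons] at hsum
    simp only [kval, List.map_cons, List.sum_cons] at hsum
    refine MGr.cons acc 0 p (acc + p.1 - bn p.2) _ _ ⟨hps, by omega, by omega⟩ ?_
    apply ih _ seg hlen
    · simp only [kval]; omega
    · intro q hq; exact hred q (by simp [hq])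
    · intro h0
      have : p.1 = 0 := by omega
      exact ((blackFirst_cons p seg).1 (hbf (by omega))).1 this
    · intro q hq
      apply hlast q
      rcases seg with _ | ⟨q', seg⟩
      · simp at hlen
      · simpa [List.getLast?_cons_cons] using hq

lemma mgr_of_mesonic {c : List ℕ} {g : Komp} (h : MesonicGlide c g) : MGr 0 c g := by
  induction h with
  | zeros k => exact mgr_zeros k
  | block z v hv seg a' g' hlen hseg h ih =>
    obtain ⟨h1, h2, h3, h4⟩ := hseg
    exact mgr_block v hv a' g' ih z 0 seg hlen (by simpa using h1) h2 (fun _ => h3) h4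

lemma mesonic_aux {acc : ℕ} {c : List ℕ} {g : Komp} (h : MGr acc c g) :
    (acc = 0 ∧ ∃ k, c = List.replicate k 0 ∧ g = List.replicate k ((0 : ℕ), false)) ∨
    ∃ z v seg a' g', 0 < v ∧ c = List.replicate z 0 ++ v :: a' ∧ g = seg ++ g' ∧
      seg.length = z + 1 ∧ (kval seg).sum + acc = v + kex seg ∧
      (∀ p ∈ seg, p.2 = true → 0 < p.1) ∧ (acc = 0 → BlackFirst seg) ∧
      (∀ p ∈ seg.getLast?, p.1 ≠ 0) ∧ MesonicGlide a' g' := by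
  induction h with
  | nil => exact Or.inl ⟨rfl, 0, rfl, rfl⟩
  | cons acc v p acc' c g hs h ih =>
    obtain ⟨s1, s2, s3⟩ := hs
    rcases Nat.eq_zero_or_pos v with rfl | hv
    · have s2 := s2 rfl
      rcases ih with ⟨h0, k, rfl, rfl⟩ | ⟨z, v, seg, a', g', hv, rfl, rfl, hl, hsum, hred, hbf, hlast, hm⟩
      · left
        rcases p with ⟨x, _ | _⟩
        · simp [bn] at s2
          refine ⟨by omega, k + 1, by rw [List.replicate_succ], ?_⟩
          rw [List.replicate_succ]
          congr 2
          omega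
        · simp [bn] at s1 s2; omega
      · right
        refine ⟨z + 1, v, p :: seg, a', g', hv, by simp [List.replicate_succ], by simp, by simp [hl],
          ?_, ?_, ?_, ?_, hm⟩
        · rw [kex_cons]
          simp only [kval, List.map_cons, List.sum_cons] at hsum ⊢
          omega
        · intro q hq hq2
          rcases List.mem_cons.1 hq with rfl | hq
          · exact (s1 hq2).1
          · exact hred q hq hq2
        · intro h0
          rw [blackFirst_cons]
          have hp2 : p.2 = false := by
            by_contra hc
            have := s1 (by simpa using hc)
            omega
          refine ⟨fun hp => hbf ?_, fun _ => hp2⟩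
          simp [hp2, bn] at s2; omega
        · intro q hq
          apply hlast q
          rcases seg with _ | ⟨q', seg⟩
          · simp at hl
          · simpa [List.getLast?_cons_cons] using hq
    · right
      obtain ⟨rfl, hp, he⟩ := s3 hv
      refine ⟨0, v, [p], c, g, hv, by simp, by simp, by simp, ?_, ?_, ?_, ?_, ?_⟩
      · rw [kex_cons]; simp [kval, kex]; omega
      · intro q hq _
        simp at hq; subst hq; exact hp
      · intro h0
        rw [blackFirst_cons]
        refine ⟨by omega, fun _ => ?_⟩
        by_contra hc
        have := s1 (by simpa using hc)
        omega
      · intro q hq; simp at hq; subst hq; omega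
      · rcases ih with ⟨-, k, rfl, rfl⟩ | ⟨z, v, seg, a', g', hv, rfl, rfl, hl, hsum, hred, hbf, hlast, hm⟩
        · exact MesonicGlide.zeros k
        · exact MesonicGlide.block z v hv seg a' g' hl ⟨by simpa using hsum, hred, hbf rfl, hlast⟩ hm

lemma mesonic_iff {c : List ℕ} {g : Komp} : MesonicGlide c g ↔ MGr 0 c g := by
  refine ⟨mgr_of_mesonic, fun h => ?_⟩
  rcases mesonic_aux h with ⟨-, k, rfl, rfl⟩ | ⟨z, v, seg, a', g', hv, rfl, rfl, hl, hsum, hred, hbf, hlast, hm⟩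
  · exact MesonicGlide.zeros k
  · exact MesonicGlide.block z v hv seg a' g' hl ⟨by simpa using hsum, hred, hbf rfl, hlast⟩ hm

lemma mgr_ofFn (n : ℕ) : ∀ (c : ℕ → ℕ) (p : ℕ → ℕ × Bool) (A : ℕ → ℕ),
    (∀ k < n, Stp (A k) (c k) (p k) (A (k+1))) → A n = 0 →
    MGr (A 0) (List.ofFn fun i : Fin n => c i.1) (List.ofFn fun i : Fin n => p i.1) := by
  induction n with
  | zero => intro c p A _ h; rw [h]; simpa using MGr.nil
  | succ n ih =>
    intro c p A hs h
    rw [List.ofFn_succ, List.ofFn_succ]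
    exact MGr.cons _ _ _ (A 1) _ _ (hs 0 (by omega))
      (ih (fun k => c (k+1)) (fun k => p (k+1)) (fun k => A (k+1))
        (fun k hk => hs (k+1) (by omega)) h)

lemma ofFn_mgr (n : ℕ) : ∀ (c : ℕ → ℕ) (acc : ℕ) (g : Komp),
    MGr acc (List.ofFn fun i : Fin n => c i.1) g →
    ∃ (p : ℕ → ℕ × Bool) (A : ℕ → ℕ), g = (List.ofFn fun i : Fin n => p i.1) ∧ A 0 = acc ∧ A n = 0 ∧
      ∀ k < n, Stp (A k) (c k) (p k) (A (k+1)) := by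
  induction n with
  | zero =>
    intro c acc g h
    rw [List.ofFn_zero] at h
    cases h
    exact ⟨fun _ => (0, false), fun _ => 0, by simp, rfl, rfl, by simp⟩
  | succ n ih =>
    intro c acc g h
    rw [List.ofFn_succ] at h
    rcases h with _ | ⟨_, _, p0, acc', _, g', hs, h⟩
    obtain ⟨p, A, rfl, h0, hn, hst⟩ := ih (fun k => c (k+1)) acc' g' h
    refine ⟨fun k => Nat.casesOn k p0 p, fun k => Nat.casesOn k acc A, ?_, rfl, hn, ?_⟩
    · rw [List.ofFn_succ]; rfl
    · intro k hk
      rcases k with _ | k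
      · subst h0; exact hs
      · exact hst k (by omega)

lemma mem_skyline {a : List ℕ} {i j : ℕ} : (i, j) ∈ skyline a ↔ SBox a i j := by
  unfold skyline SBox shapeLen
  simp only [Finset.mem_biUnion, Finset.mem_range, Finset.mem_image, Prod.mk.injEq]
  constructor
  · rintro ⟨i', hi', j', hj', rfl, rfl⟩
    refine ⟨by omega, by omega, by omega, ?_⟩
    simpa using hj'
  · rintro ⟨h1, h2, h3, h4⟩
    exact ⟨i - 1, by omega, j - 1, by omega, by omega, by omega⟩

def DD (a : List ℕ) (T : SVF) (u : ℕ) : Finset ℕ :=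
  ((skyline a).filter fun p => u ∈ T p.1 p.2).image Prod.snd

lemma mem_DD {a : List ℕ} {T : SVF} (hT : LASSF a T) {u j : ℕ} :
    j ∈ DD a T u ↔ ∃ i, u ∈ T i j := by
  unfold DD
  simp only [Finset.mem_image, Finset.mem_filter]
  constructor
  · rintro ⟨⟨i, j'⟩, ⟨h1, h2⟩, rfl⟩
    exact ⟨i, h2⟩
  · rintro ⟨i, hi⟩
    exact ⟨(i, j), ⟨mem_skyline.2 ((hT.1.1 _ _).1 ⟨_, hi⟩), hi⟩, rfl⟩

lemma col_eq {a : List ℕ} {T : SVF} (hT : LASSF a T) {u i i' j : ℕ} (h : u ∈ T i j)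
    (h' : u ∈ T i' j) : i = i' := by
  by_contra hc
  exact hT.1.2.2.1 j i i' hc _ h h'

lemma card_DD {a : List ℕ} {T : SVF} (hT : LASSF a T) (u : ℕ) :
    (DD a T u).card = wtF a T u := by
  unfold DD wtF
  apply Finset.card_image_of_injOn
  rintro ⟨i, j⟩ h ⟨i', j'⟩ h' he
  simp only [Finset.coe_filter, Set.mem_setOf_eq] at h h'
  simp only at he
  subst he
  rw [col_eq hT h.2 h'.2]

lemma DD_pos {a : List ℕ} {T : SVF} (hT : LASSF a T) (u : ℕ) :
    0 < (DD a T u).card ↔ Appears T u := by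
  rw [Finset.card_pos]
  constructor
  · rintro ⟨j, hj⟩
    obtain ⟨i, hi⟩ := (mem_DD hT).1 hj
    exact ⟨i, j, hi⟩
  · rintro ⟨i, j, hi⟩
    exact ⟨j, (mem_DD hT).2 ⟨i, hi⟩⟩

def rk (C : Finset ℕ) (j : ℕ) : ℕ := (C.filter (fun x => j < x)).card

lemma rk_lt {C : Finset ℕ} {j : ℕ} (h : j ∈ C) : rk C j < C.card := by
  apply Finset.card_lt_card
  rw [Finset.ssubset_iff_of_subset (Finset.filter_subset _ _)]
  exact ⟨j, h, by simp⟩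

lemma rk_anti {C : Finset ℕ} {j j' : ℕ} (h : j < j') (hj : j' ∈ C) : rk C j' < rk C j := by
  apply Finset.card_lt_card
  rw [Finset.ssubset_iff_of_subset]
  · exact ⟨j', by simp [hj, h], by simp⟩
  · intro x hx
    simp only [Finset.mem_filter] at hx ⊢
    exact ⟨hx.1, by omega⟩

lemma rk_le {C : Finset ℕ} {j j' : ℕ} (hj : j' ∈ C) (h : rk C j ≤ rk C j') : j' ≤ j := by
  by_contra hc
  have := rk_anti (not_le.1 hc) hj
  omega

lemma rk_inj {C : Finset ℕ} : Set.InjOn (rk C) C := by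
  intro x hx y hy h
  exact le_antisymm (rk_le hx h.symm.le) (rk_le hy h.le)

lemma rk_image (C : Finset ℕ) : C.image (rk C) = Finset.range C.card := by
  apply Finset.eq_of_subset_of_card_le
  · intro x hx
    obtain ⟨j, hj, rfl⟩ := Finset.mem_image.1 hx
    exact Finset.mem_range.2 (rk_lt hj)
  · rw [Finset.card_image_of_injOn rk_inj, Finset.card_range]

lemma rk_surj {C : Finset ℕ} {ρ : ℕ} (h : ρ < C.card) : ∃ j ∈ C, rk C j = ρ := by
  have := Finset.mem_range.2 h
  rw [← rk_image] at this
  simpa using this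

lemma rk_count {C : Finset ℕ} {lo x : ℕ} (h : lo + x ≤ C.card) :
    (C.filter (fun j => lo ≤ rk C j ∧ rk C j < lo + x)).card = x := by
  rw [← Finset.card_image_of_injOn (f := rk C) (rk_inj.mono (by
    intro y hy; exact (Finset.mem_filter.1 hy).1))]
  have : (C.filter (fun j => lo ≤ rk C j ∧ rk C j < lo + x)).image (rk C) = Finset.Ico lo (lo + x) := by
    ext y
    simp only [Finset.mem_image, Finset.mem_filter, Finset.mem_Ico]
    constructor
    · rintro ⟨j, ⟨-, h2⟩, rfl⟩; exact h2
    · intro hy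
      obtain ⟨j, hj, rfl⟩ := rk_surj (C := C) (ρ := y) (by omega)
      exact ⟨j, ⟨hj, hy⟩, rfl⟩
  rw [this]; simp

lemma rk_upper {C U : Finset ℕ} (hU : U ⊆ C) (hup : ∀ j ∈ U, ∀ j2 ∈ C, j < j2 → j2 ∈ U) {j : ℕ}
    (hj : j ∈ C) : j ∈ U ↔ rk C j < U.card := by
  constructor
  · intro h
    apply Finset.card_lt_card
    rw [Finset.ssubset_iff_of_subset]
    · exact ⟨j, h, by simp⟩
    · intro x hx
      simp only [Finset.mem_filter] at hx
      exact hup j h x hx.1 hx.2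
  · intro h
    by_contra hc
    have : U.card ≤ rk C j := by
      apply Finset.card_le_card
      intro x hx
      simp only [Finset.mem_filter]
      refine ⟨hU hx, ?_⟩
      by_contra hc2
      rcases (not_lt.1 hc2).lt_or_eq with h' | h'
      · exact hc (hup x hx j hj h')
      · exact hc (h' ▸ hx)
    omega

section fib
variable {a : List ℕ} {T S : SVF}

noncomputable def BB (a : List ℕ) (S T : SVF) (u : ℕ) : Finset ℕ :=
  ((Finset.range u).filter (fun u' => ph a.length S u' = ph a.length S u)).biUnion (DD a T)

noncomputable def kw (a : List ℕ) (S T : SVF) (u : ℕ) : ℕ × Bool :=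
  (wtF a T u, decide (BB a S T u ∩ DD a T u).Nonempty)

lemma mem_BB {u j : ℕ} : j ∈ BB a S T u ↔ ∃ u' < u, ph a.length S u' = ph a.length S u ∧
    j ∈ DD a T u' := by
  simp [BB, and_assoc]

variable (hS : LASSF a S) (h : RR a.length T S)
include hS h

lemma D_sub {u j : ℕ} (hj : j ∈ DD a T u) : j ∈ DD a S (ph a.length S u) := by
  obtain ⟨i, hi⟩ := (mem_DD (h.lassf hS)).1 hj
  exact (mem_DD hS).2 ⟨i, h.img _ _ _ hi⟩

lemma D_sur {s j : ℕ} (hj : j ∈ DD a S s) : ∃ u, j ∈ DD a T u ∧ ph a.length S u = s := by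
  obtain ⟨i, hi⟩ := (mem_DD hS).1 hj
  obtain ⟨u, hu, he⟩ := h.sur _ _ _ hi
  exact ⟨u, (mem_DD (h.lassf hS)).2 ⟨i, hu⟩, he⟩

lemma D_ord {u u' j j' : ℕ} (hlt : u < u') (he : ph a.length S u = ph a.length S u')
    (hj : j ∈ DD a T u) (hj' : j' ∈ DD a T u') : j' ≤ j := by
  obtain ⟨i, hi⟩ := (mem_DD (h.lassf hS)).1 hj
  obtain ⟨i', hi'⟩ := (mem_DD (h.lassf hS)).1 hj'
  rcases h.ord _ _ _ _ _ _ hlt he hi hi' with h' | h' <;> omega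

lemma T_iff {u i j : ℕ} : u ∈ T i j ↔ ph a.length S u ∈ S i j ∧ j ∈ DD a T u := by
  constructor
  · intro hu
    exact ⟨h.img _ _ _ hu, (mem_DD (h.lassf hS)).2 ⟨i, hu⟩⟩
  · rintro ⟨h1, h2⟩
    obtain ⟨i', hi'⟩ := (mem_DD (h.lassf hS)).1 h2
    rw [col_eq hS h1 (h.img _ _ _ hi')]
    exact hi'

lemma inter_card (u : ℕ) : (BB a S T u ∩ DD a T u).card = bn (kw a S T u).2 := by
  have hle : (BB a S T u ∩ DD a T u).card ≤ 1 := by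
    rw [Finset.card_le_one]
    have key : ∀ x ∈ BB a S T u ∩ DD a T u, ∀ y ∈ BB a S T u ∩ DD a T u, x ≤ y := by
      intro x hx y hy
      obtain ⟨u', h1, h2, h3⟩ := mem_BB.1 (Finset.mem_inter.1 hy).1
      exact D_ord hS h h1 h2 h3 (Finset.mem_inter.1 hx).2
    exact fun x hx y hy => le_antisymm (key x hx y hy) (key y hy x hx)
  by_cases hn : (BB a S T u ∩ DD a T u).Nonempty
  · have := hn.card_pos
    simp [kw, hn, bn]; omega
  · simp only [kw, hn, bn]
    rw [Finset.not_nonempty_iff_eq_empty] at hn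
    simp [hn]

lemma union_card (u : ℕ) : (BB a S T u ∪ DD a T u).card + bn (kw a S T u).2 =
    (BB a S T u).card + (kw a S T u).1 := by
  rw [← inter_card hS h, Finset.card_union_add_card_inter, card_DD (h.lassf hS)]
  rfl

lemma mem_EE {u j : ℕ} : j ∈ BB a S T u ∪ DD a T u ↔ ∃ u' ≤ u, ph a.length S u' = ph a.length S u ∧
    j ∈ DD a T u' := by
  rw [Finset.mem_union, mem_BB]
  constructor
  · rintro (⟨u', h1, h2⟩ | h2)
    · exact ⟨u', h1.le, h2⟩
    · exact ⟨u, le_rfl, rfl, h2⟩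
  · rintro ⟨u', h1, h2, h3⟩
    rcases h1.lt_or_eq with h' | rfl
    · exact Or.inl ⟨u', h', h2, h3⟩
    · exact Or.inr h3

lemma BB_upper {u : ℕ} : ∀ j ∈ BB a S T u, ∀ j2 ∈ DD a S (ph a.length S u), j < j2 →
    j2 ∈ BB a S T u := by
  intro j hj j2 hj2 hlt
  obtain ⟨u', h1, h2, h3⟩ := mem_BB.1 hj
  obtain ⟨u'', h4, h5⟩ := D_sur hS h hj2
  rw [mem_BB]
  refine ⟨u'', ?_, h5, h4⟩
  by_contra hc
  have := D_ord hS h (show u' < u'' by omega) (by rw [h2, h5]) h3 h4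
  omega

lemma EE_upper {u : ℕ} : ∀ j ∈ BB a S T u ∪ DD a T u, ∀ j2 ∈ DD a S (ph a.length S u), j < j2 →
    j2 ∈ BB a S T u ∪ DD a T u := by
  intro j hj j2 hj2 hlt
  rw [mem_EE hS h] at hj ⊢
  obtain ⟨u', h1, h2, h3⟩ := hj
  obtain ⟨u'', h4, h5⟩ := D_sur hS h hj2
  refine ⟨u'', ?_, h5, h4⟩
  by_contra hc
  have := D_ord hS h (show u' < u'' by omega) (by rw [h2, h5]) h3 h4
  omega

lemma BB_sub {u : ℕ} : BB a S T u ⊆ DD a S (ph a.length S u) := by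
  intro j hj
  obtain ⟨u', h1, h2, h3⟩ := mem_BB.1 hj
  rw [← h2]; exact D_sub hS h h3

lemma EE_sub {u : ℕ} : BB a S T u ∪ DD a T u ⊆ DD a S (ph a.length S u) :=
  Finset.union_subset (BB_sub hS h) (fun _ hj => D_sub hS h hj)

lemma canon {u j : ℕ} : j ∈ DD a T u ↔ j ∈ DD a S (ph a.length S u) ∧
    (BB a S T u).card ≤ rk (DD a S (ph a.length S u)) j + bn (kw a S T u).2 ∧
    rk (DD a S (ph a.length S u)) j + bn (kw a S T u).2 < (BB a S T u).card + (kw a S T u).1 := by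
  rw [← union_card hS h, Nat.add_lt_add_iff_right]
  set C := DD a S (ph a.length S u) with hC
  have hBU : ∀ j ∈ C, (j ∈ BB a S T u ↔ rk C j < (BB a S T u).card) :=
    fun j hj => rk_upper (BB_sub hS h) (BB_upper hS h) hj
  constructor
  · intro hj
    have hjC : j ∈ C := D_sub hS h hj
    refine ⟨hjC, ?_, (rk_upper (EE_sub hS h) (EE_upper hS h) hjC).1 (Finset.mem_union_right _ hj)⟩
    by_cases hB : j ∈ BB a S T u
    · have : (kw a S T u).2 = true := by
        simp only [kw, decide_eq_true_eq]
        exact ⟨j, Finset.mem_inter.2 ⟨hB, hj⟩⟩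
      rw [this]
      have : ((BB a S T u).erase j).card ≤ rk C j := by
        apply Finset.card_le_card
        intro x hx
        rw [Finset.mem_erase] at hx
        rw [Finset.mem_filter]
        refine ⟨BB_sub hS h hx.2, ?_⟩
        obtain ⟨u', h1, h2, h3⟩ := mem_BB.1 hx.2
        have := D_ord hS h h1 h2 h3 hj
        have := hx.1
        omega
      rw [Finset.card_erase_of_mem hB] at this
      simp [bn]; omega
    · have := (hBU j hjC).not.1 hB
      omega
  · rintro ⟨hjC, h1, h2⟩
    have hE := (rk_upper (EE_sub hS h) (EE_upper hS h) hjC).2 h2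
    rcases Finset.mem_union.1 hE with hB | hD
    · have hlt := (hBU j hjC).1 hB
      by_cases hr : (kw a S T u).2 = true
      · have hr' := hr
        simp only [kw, decide_eq_true_eq] at hr'
        obtain ⟨y, hy⟩ := hr'
        rw [Finset.mem_inter] at hy
        have hyC : y ∈ C := D_sub hS h hy.2
        -- all of B is to the right of y
        have hyle : y ≤ j := by
          obtain ⟨u', g1, g2, g3⟩ := mem_BB.1 hB
          exact D_ord hS h g1 g2 g3 hy.2
        rcases hyle.lt_or_eq with h' | rfl
        · have h3 := rk_anti h' hjC
          have h4 := (hBU y hyC).1 hy.1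
          rw [hr] at h1
          simp only [bn, if_true] at h1
          omega
        · exact hy.2
      · simp [bn, hr] at h1
        omega
    · exact hD

lemma stp {u : ℕ} (h1 : 1 ≤ u) (hn : u ≤ a.length) :
    Stp (BB a S T u).card (wtF a S u) (kw a S T u) (BB a S T (u+1)).card := by
  have hT := h.lassf hS
  refine ⟨?_, ?_, ?_⟩
  · intro hr
    simp only [kw, decide_eq_true_eq] at hr
    obtain ⟨y, hy⟩ := hr
    rw [Finset.mem_inter] at hy
    refine ⟨?_, Finset.card_pos.2 ⟨y, hy.1⟩⟩
    simp only [kw]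
    rw [← card_DD hT]
    exact Finset.card_pos.2 ⟨y, hy.2⟩
  · intro hc
    have hp : ¬ PP a.length S u := by
      rintro (h' | h' | h')
      · omega
      · rw [← DD_pos hS, card_DD hS] at h'; omega
      · omega
    have : BB a S T (u+1) = BB a S T u ∪ DD a T u := by
      ext j
      rw [mem_EE hS h, mem_BB, ph_succ hp]
      simp only [Nat.lt_succ_iff]
    rw [this, union_card hS h]
  · intro hc
    rw [← card_DD hS] at hc
    have hap := (DD_pos hS u).1 hc
    have hph : ph a.length S u = u := ph_fix (Or.inr (Or.inl hap))
    refine ⟨?_, ?_, ?_⟩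
    · rw [Finset.card_eq_zero, Finset.eq_empty_iff_forall_notMem]
      intro j hj
      obtain ⟨u', g1, g2, g3⟩ := mem_BB.1 hj
      have := ph_mono (n := a.length) (S := S) (Nat.lt_succ_iff.1 g1)
      have := le_ph a.length S (u+1)
      omega
    · simp only [kw]
      rw [← card_DD hT, DD_pos hT]
      exact h.app u hap
    · rw [← union_card hS h, ← card_DD hS]
      congr 2
      apply le_antisymm
      · have := EE_sub hS h (u := u); rwa [hph] at this
      · intro j hj
        obtain ⟨u', g1, g2⟩ := D_sur hS h hj
        rw [mem_EE hS h]
        exact ⟨u', by rw [← g2]; exact le_ph _ _ _, by rw [g2, hph], g1⟩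

lemma BB_one : BB a S T 1 = ∅ := by
  rw [Finset.eq_empty_iff_forall_notMem]
  intro j hj
  obtain ⟨u', g1, g2, g3⟩ := mem_BB.1 hj
  have hT := h.lassf hS
  obtain ⟨i, hi⟩ := (mem_DD hT).1 g3
  have := hT.1.2.1 _ _ _ hi
  omega

lemma BB_last : BB a S T (a.length + 1) = ∅ := by
  rw [Finset.eq_empty_iff_forall_notMem]
  intro j hj
  have := BB_sub hS h hj
  rw [ph_fix (Or.inr (Or.inr (by omega)))] at this
  obtain ⟨i, hi⟩ := (mem_DD hS).1 this
  have := S_le hS hi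
  omega

lemma kwt_mgr : MGr 0 (List.ofFn fun i : Fin a.length => wtF a S (i.1 + 1))
    (List.ofFn fun i : Fin a.length => kw a S T (i.1 + 1)) := by
  have := mgr_ofFn a.length (fun k => wtF a S (k+1)) (fun k => kw a S T (k+1))
    (fun k => (BB a S T (k+1)).card) (fun k hk => stp hS h (by omega) (by omega))
    (by simp [BB_last hS h])
  simpa [BB_one hS h] using this

lemma T_range {u i j : ℕ} (hu : u ∈ T i j) : 1 ≤ u ∧ u ≤ a.length :=
  ⟨(h.lassf hS).1.2.1 _ _ _ hu, S_le (h.lassf hS) hu⟩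

lemma kwt_inj {T' : SVF} (h' : RR a.length T' S)
    (he : ∀ u, 1 ≤ u → u ≤ a.length → kw a S T u = kw a S T' u) : T = T' := by
  have hB : ∀ k, k ≤ a.length → (BB a S T (k+1)).card = (BB a S T' (k+1)).card := by
    intro k
    induction k with
    | zero => intro _; rw [BB_one hS h, BB_one hS h']
    | succ k ih =>
      intro hk
      have e1 := stp hS h (u := k+1) (by omega) hk
      have e2 := stp hS h' (u := k+1) (by omega) hk
      rw [← he (k+1) (by omega) hk] at e2
      rw [← ih (by omega)] at e2
      rcases Nat.eq_zero_or_pos (wtF a S (k+1)) with h0 | h0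
      · have := e1.2.1 h0
        have := e2.2.1 h0
        omega
      · rw [(e1.2.2 h0).1, (e2.2.2 h0).1]
  have hiff : ∀ u i j, 1 ≤ u → u ≤ a.length → (u ∈ T i j ↔ u ∈ T' i j) := by
    intro u i j h1 h2
    rw [T_iff hS h, T_iff hS h', canon hS h, canon hS h', he u h1 h2]
    have := hB (u-1) (by omega)
    rw [Nat.sub_add_cancel h1] at this
    rw [this]
  funext i j
  ext u
  constructor
  · intro hu
    have := T_range hS h hu
    exact (hiff u i j this.1 this.2).1 hu
  · intro hu
    have := T_range hS h' hu
    exact (hiff u i j this.1 this.2).2 hu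

end fib

section sur
variable {a : List ℕ} {S : SVF}

open Classical in
noncomputable def Tg (a : List ℕ) (S : SVF) (p : ℕ → ℕ × Bool) (A : ℕ → ℕ) : SVF := fun i j =>
  (Finset.Icc 1 a.length).filter fun u => ph a.length S u ∈ S i j ∧
    A u ≤ rk (DD a S (ph a.length S u)) j + bn (p u).2 ∧
    rk (DD a S (ph a.length S u)) j + bn (p u).2 < A u + (p u).1

variable {p : ℕ → ℕ × Bool} {A : ℕ → ℕ}
variable (hS : LASSF a S) (hA1 : A 1 = 0) (hAn : A (a.length + 1) = 0)
  (hst : ∀ u, 1 ≤ u → u ≤ a.length → Stp (A u) (wtF a S u) (p u) (A (u+1)))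

lemma mem_Tg {u i j : ℕ} : u ∈ Tg a S p A i j ↔ (1 ≤ u ∧ u ≤ a.length) ∧
    ph a.length S u ∈ S i j ∧ A u ≤ rk (DD a S (ph a.length S u)) j + bn (p u).2 ∧
    rk (DD a S (ph a.length S u)) j + bn (p u).2 < A u + (p u).1 := by
  simp [Tg]

include hS hst

lemma bn_le {u : ℕ} (h1 : 1 ≤ u) (h2 : u ≤ a.length) : bn (p u).2 ≤ (p u).1 ∧ bn (p u).2 ≤ A u := by
  have := (hst u h1 h2).1
  by_cases hr : (p u).2 = true
  · have := this hr; simp [bn, hr]; omega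
  · simp [bn, hr]

lemma wt_zero {u : ℕ} (h : u < ph a.length S u) : wtF a S u = 0 := by
  by_contra hc
  rw [← card_DD hS] at hc
  have := (DD_pos hS u).1 (by omega)
  have := ph_fix (n := a.length) (S := S) (u := u) (Or.inr (Or.inl this))
  omega

lemma A_mono {u : ℕ} (h1 : 1 ≤ u) : ∀ w, u + 1 ≤ w → w ≤ a.length + 1 →
    ph a.length S u = ph a.length S w → A u + (p u).1 ≤ A w + bn (p u).2 := by
  intro w hw
  induction w, hw using Nat.le_induction with
  | base =>
    intro h2 he
    have h3 := le_ph a.length S (u+1)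
    have := (hst u h1 (by omega)).2.1 (wt_zero hS hst (by omega))
    omega
  | succ w hw ih =>
    intro h2 he
    have h3 := le_ph a.length S (w+1)
    have hm : ph a.length S w = ph a.length S u := ph_mid (by omega) (by omega)
    have := ih (by omega) hm.symm
    have h4 := (hst w (by omega) (by omega)).2.1 (wt_zero hS hst (by omega))
    have h5 := bn_le hS hst (u := w) (by omega) (by omega)
    omega

include hAn in
lemma A_top {u : ℕ} (h1 : 1 ≤ u) (h2 : u ≤ a.length) :
    A u + (p u).1 ≤ (DD a S (ph a.length S u)).card + bn (p u).2 := by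
  have hs := ph_spec a.length S u
  have htop : ∀ s, 1 ≤ s → s ≤ a.length → PP a.length S s →
      A s + (p s).1 = (DD a S s).card + bn (p s).2 := by
    intro s g1 g2 hp
    have hap : Appears S s := by
      rcases hp with h' | h' | h'
      · omega
      · exact h'
      · omega
    rw [card_DD hS]
    apply ((hst s g1 g2).2.2 _).2.2
    rw [← card_DD hS]; exact (DD_pos hS s).2 hap
  by_cases hn : ph a.length S u ≤ a.length
  · rcases hs.1.lt_or_eq with hlt | heq
    · have e1 := A_mono hS hst h1 _ hlt (by omega) (ph_fix hs.2).symm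
      have e2 := htop _ (by omega) hn hs.2
      have e3 := bn_le hS hst (u := ph a.length S u) (by omega) hn
      omega
    · rw [← heq] at hs ⊢
      exact (htop u h1 h2 hs.2).le
  · have : ph a.length S u ≤ a.length + 1 := ph_le (by omega) (Or.inr (Or.inr (by omega)))
    have e0 : ph a.length S u = a.length + 1 := by omega
    have e1 := A_mono hS hst h1 (a.length + 1) (by omega) le_rfl
      (by rw [ph_fix (u := a.length + 1) (Or.inr (Or.inr (by omega)))]; exact e0)
    omega

include hA1 in
lemma A_cov : ∀ k ρ, k ≤ a.length → ρ < A (k+1) → ∃ u', 1 ≤ u' ∧ u' < k + 1 ∧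
    ph a.length S u' = ph a.length S (k+1) ∧ A u' ≤ ρ ∧ ρ + bn (p u').2 < A u' + (p u').1 := by
  intro k
  induction k with
  | zero => intro ρ _ h; simp at h; omega
  | succ k ih =>
    intro ρ hk hρ
    have hs := hst (k+1) (by omega) hk
    rcases Nat.eq_zero_or_pos (wtF a S (k+1)) with h0 | h0
    · have hp : ¬ PP a.length S (k+1) := by
        rintro (h' | h' | h')
        · omega
        · rw [← DD_pos hS, card_DD hS] at h'; omega
        · omega
      have e := hs.2.1 h0
      rw [ph_succ hp]
      by_cases hc : ρ < A (k+1)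
      · obtain ⟨u', g1, g2, g3, g4⟩ := ih ρ (by omega) hc
        exact ⟨u', g1, by omega, g3, g4⟩
      · exact ⟨k+1, by omega, by omega, rfl, by omega, by omega⟩
    · have := (hs.2.2 h0).1; omega

include hA1 in
lemma Tg_RR : RR a.length (Tg a S p A) S := by
  refine ⟨?_, ?_, ?_, ?_⟩
  · intro i j u hu
    exact (mem_Tg.1 hu).2.1
  · intro i j s hs
    have hap : Appears S s := ⟨_, _, hs⟩
    have hph : ph a.length S s = s := ph_fix (Or.inr (Or.inl hap))
    have hs1 := hS.1.2.1 _ _ _ hs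
    have hsn := S_le hS hs
    have hjC : j ∈ DD a S s := (mem_DD hS).2 ⟨i, hs⟩
    have hr := rk_lt hjC
    have hstp := (hst s hs1 hsn).2.2 (by rw [← card_DD hS, DD_pos hS]; exact hap)
    rw [card_DD hS] at hr
    by_cases hc : rk (DD a S s) j < A s
    · obtain ⟨u', g1, g2, g3, g4, g5⟩ := A_cov hS hA1 hst (s-1) (rk (DD a S s) j) (by omega)
        (by rwa [Nat.sub_add_cancel hs1])
      rw [Nat.sub_add_cancel hs1, hph] at g3
      refine ⟨u', mem_Tg.2 ⟨⟨g1, by omega⟩, ?_⟩, g3⟩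
      rw [g3]
      exact ⟨hs, by omega, g5⟩
    · refine ⟨s, mem_Tg.2 ⟨⟨hs1, hsn⟩, ?_⟩, hph⟩
      rw [hph]
      exact ⟨hs, by omega, by omega⟩
  · intro u u' i j i' j' hlt he hu hu'
    obtain ⟨⟨a1, a2⟩, a3, a4, a5⟩ := mem_Tg.1 hu
    obtain ⟨⟨b1, b2⟩, b3, b4, b5⟩ := mem_Tg.1 hu'
    rw [← he] at b3 b4 b5
    have e1 := A_mono hS hst a1 u' hlt (by omega) he
    have hbn : bn (p u').2 ≤ 1 := by unfold bn; split_ifs <;> omega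
    have hle : j' ≤ j := rk_le ((mem_DD hS).2 ⟨i', b3⟩) (by omega)
    rcases hle.lt_or_eq with h' | rfl
    · exact Or.inl h'
    · exact Or.inr ⟨col_eq hS b3 a3, rfl⟩
  · intro s hap
    have hph : ph a.length S s = s := ph_fix (Or.inr (Or.inl hap))
    obtain ⟨i0, j0, hs⟩ := hap
    have hs1 := hS.1.2.1 _ _ _ hs
    have hsn := S_le hS hs
    have hpos : 0 < wtF a S s := by rw [← card_DD hS, DD_pos hS]; exact ⟨_, _, hs⟩
    have hstp := (hst s hs1 hsn).2.2 hpos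
    obtain ⟨j, hj, hrk⟩ := rk_surj (C := DD a S s) (ρ := wtF a S s - 1)
      (by rw [card_DD hS]; omega)
    obtain ⟨i, hi⟩ := (mem_DD hS).1 hj
    refine ⟨i, j, mem_Tg.2 ⟨⟨hs1, hsn⟩, ?_⟩⟩
    rw [hph, hrk]
    exact ⟨hi, by omega, by omega⟩

include hA1 hAn in
lemma Tg_kw {u : ℕ} (h1 : 1 ≤ u) (h2 : u ≤ a.length) : kw a S (Tg a S p A) u = p u := by
  have hR := Tg_RR hS hA1 hst
  have hT := hR.lassf hS
  have hmem : ∀ u, 1 ≤ u → u ≤ a.length → ∀ j, j ∈ DD a (Tg a S p A) u ↔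
      j ∈ DD a S (ph a.length S u) ∧ A u ≤ rk (DD a S (ph a.length S u)) j + bn (p u).2 ∧
      rk (DD a S (ph a.length S u)) j + bn (p u).2 < A u + (p u).1 := by
    intro u h1 h2 j
    rw [mem_DD hT, mem_DD hS]
    constructor
    · rintro ⟨i, hi⟩
      obtain ⟨-, g2, g3⟩ := mem_Tg.1 hi
      exact ⟨⟨i, g2⟩, g3⟩
    · rintro ⟨⟨i, hi⟩, g⟩
      exact ⟨i, mem_Tg.2 ⟨⟨h1, h2⟩, hi, g⟩⟩
  have htop := A_top hS hAn hst h1 h2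
  have hb := bn_le hS hst h1 h2
  apply Prod.ext
  · simp only [kw]
    rw [← card_DD hT]
    rw [← rk_count (C := DD a S (ph a.length S u)) (lo := A u - bn (p u).2) (x := (p u).1) (by omega)]
    congr 1
    ext j
    rw [hmem u h1 h2, Finset.mem_filter]
    refine and_congr_right fun _ => ?_
    constructor <;> rintro ⟨q1, q2⟩ <;> constructor <;> omega
  · simp only [kw]
    rw [Bool.eq_iff_iff, decide_eq_true_eq]
    constructor
    · rintro ⟨j, hj⟩
      rw [Finset.mem_inter, mem_BB] at hj
      obtain ⟨⟨u', g1, g2, g3⟩, g4⟩ := hj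
      have hu' : 1 ≤ u' := by
        obtain ⟨i, hi⟩ := (mem_DD hT).1 g3
        exact hT.1.2.1 _ _ _ hi
      rw [hmem u' hu' (by omega), g2] at g3
      rw [hmem u h1 h2] at g4
      have e1 := A_mono hS hst hu' u g1 (by omega) g2
      by_contra hc
      simp only [bn, hc] at g4
      simp at g4
      omega
    · intro hr
      have hs := (hst u h1 h2).1 hr
      have hbr : bn (p u).2 = 1 := by simp [bn, hr]
      obtain ⟨u', g1, g2, g3, g4, g5⟩ := A_cov hS hA1 hst (u-1) (A u - 1) (by omega)
        (by rw [Nat.sub_add_cancel h1]; omega)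
      rw [Nat.sub_add_cancel h1] at g3 g2
      obtain ⟨j, hj, hrk⟩ := rk_surj (C := DD a S (ph a.length S u)) (ρ := A u - 1) (by omega)
      refine ⟨j, ?_⟩
      rw [Finset.mem_inter, mem_BB]
      refine ⟨⟨u', g2, g3, ?_⟩, ?_⟩
      · rw [hmem u' g1 (by omega), g3, hrk]
        exact ⟨hj, by omega, g5⟩
      · rw [hmem u h1 h2, hrk]
        exact ⟨hj, by omega, by omega⟩

end sur

lemma sizeF_eq {a : List ℕ} {T : SVF} (hT : LASSF a T) :
    sizeF a T = (List.ofFn fun i : Fin a.length => wtF a T (i.1 + 1)).sum := by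
  rw [List.sum_ofFn, Fin.sum_univ_eq_sum_range (fun i => wtF a T (i+1))]
  unfold sizeF wtF
  simp_rw [Finset.card_filter]
  rw [Finset.sum_comm]
  apply Finset.sum_congr rfl
  rintro ⟨i, j⟩ -
  rw [← Finset.card_filter]
  simp only
  symm
  apply Finset.card_bij (fun k _ => k + 1)
  · intro k hk; exact (Finset.mem_filter.1 hk).2
  · intro x _ y _ h; omega
  · intro v hv
    have := hT.1.2.1 _ _ _ hv
    have := S_le hT hv
    exact ⟨v - 1, by simp only [Finset.mem_filter, Finset.mem_range]; rw [Nat.sub_add_cancel (by omega)]; exact ⟨by omega, hv⟩, by omega⟩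

lemma vmono_eq {a : List ℕ} {T : SVF} (hT : LASSF a T) :
    xmonoPos (List.ofFn fun i : Fin a.length => wtF a T (i.1 + 1)) = vmono (wtF a T) := by
  unfold xmonoPos vmono
  rw [finprod_eq_prod_of_mulSupport_subset (s := (Finset.range a.length).image (· + 1))]
  · rw [Finset.prod_image (by intro x _ y _ h; simpa using h)]
    rw [List.length_ofFn]
    apply Finset.prod_congr rfl
    intro i hi
    have hi := Finset.mem_range.1 hi
    congr 1
    rw [List.getD_eq_getElem?_getD, List.getElem?_ofFn]
    simp [hi]
  · intro v hv
    rw [Function.mem_mulSupport] at hv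
    have h0 : 0 < wtF a T v := by
      rcases Nat.eq_zero_or_pos (wtF a T v) with h | h
      · rw [h] at hv; simp at hv
      · exact h
    rw [← card_DD hT, DD_pos hT] at h0
    obtain ⟨i, j, hij⟩ := h0
    have := hT.1.2.1 _ _ _ hij
    have := S_le hT hij
    simp only [Finset.coe_image, Set.mem_image, Finset.coe_range, Set.mem_Iio]
    exact ⟨v - 1, by omega, by omega⟩

end K15

theorem stmt15 (a : List ℕ) (S : SVF) (hS : LASSF a S) (hmh : MesonHighest S) :
    (∃ e : {T : SVF // LASSF a T ∧ Relation.ReflTransGen DStep T S} ≃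
        {g : Komp // MesonicGlide (List.ofFn fun i : Fin a.length => wtF a S (i.1 + 1)) g},
      ∀ T : {T : SVF // LASSF a T ∧ Relation.ReflTransGen DStep T S},
        kval (e T).1 = List.ofFn (fun i : Fin a.length => wtF a T.1 (i.1 + 1)) ∧
          kex (e T).1 = sizeF a T.1 - sizeF a S) ∧
    kaonPoly (List.ofFn fun i : Fin a.length => wtF a S (i.1 + 1)) =
      ∑ᶠ T ∈ {T : SVF | LASSF a T ∧ Relation.ReflTransGen DStep T S},
        MvPolynomial.C (Polynomial.X ^ (sizeF a T - sizeF a S)) * vmono (wtF a T) := by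
  classical
  set c := List.ofFn fun i : Fin a.length => wtF a S (i.1 + 1) with hc
  have hRR : ∀ T, (LASSF a T ∧ Relation.ReflTransGen DStep T S) → K15.RR a.length T S :=
    fun T hT => (K15.RR.iff hS hmh T).1 hT
  let f : {T : SVF // LASSF a T ∧ Relation.ReflTransGen DStep T S} → {g : Komp // MesonicGlide c g} :=
    fun T => ⟨List.ofFn fun i : Fin a.length => K15.kw a S T.1 (i.1 + 1),
      K15.mesonic_iff.2 (K15.kwt_mgr hS (hRR T.1 T.2))⟩
  have hf : Function.Bijective f := by
    constructor
    · rintro ⟨T, hT⟩ ⟨T', hT'⟩ he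
      have he := congrArg Subtype.val he
      simp only [f] at he
      have he := List.ofFn_injective he
      apply Subtype.ext
      apply K15.kwt_inj hS (hRR T hT) (hRR T' hT')
      intro u h1 h2
      have := congrFun he ⟨u - 1, by omega⟩
      simpa [Nat.sub_add_cancel h1] using this
    · rintro ⟨g, hg⟩
      obtain ⟨p, A, rfl, h0, hn, hst⟩ := K15.ofFn_mgr a.length (fun k => wtF a S (k+1)) 0 g
        (K15.mesonic_iff.1 hg)
      have hst' : ∀ u, 1 ≤ u → u ≤ a.length →
          K15.Stp (A (u-1)) (wtF a S u) (p (u-1)) (A (u+1-1)) := by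
        intro u h1 h2
        have := hst (u-1) (by omega)
        rw [Nat.sub_add_cancel h1] at this
        simpa using this
      have hR := K15.Tg_RR (p := fun u => p (u-1)) (A := fun u => A (u-1)) hS h0 hst'
      refine ⟨⟨_, (K15.RR.iff hS hmh _).2 hR⟩, ?_⟩
      apply Subtype.ext
      simp only [f]
      congr 1
      funext i
      exact K15.Tg_kw (p := fun u => p (u-1)) (A := fun u => A (u-1)) hS h0
        (by simpa using hn) hst' (by omega) (by omega)
  have hprop : ∀ T : {T : SVF // LASSF a T ∧ Relation.ReflTransGen DStep T S},
        kval (f T).1 = List.ofFn (fun i : Fin a.length => wtF a T.1 (i.1 + 1)) ∧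
          kex (f T).1 = sizeF a T.1 - sizeF a S := by
    intro T
    have h1 : kval (f T).1 = List.ofFn (fun i : Fin a.length => wtF a T.1 (i.1 + 1)) := by
      simp only [f, kval, List.map_ofFn]
      rfl
    refine ⟨h1, ?_⟩
    have := (K15.mesonic_iff.1 (f T).2).sum
    have hcs : c.sum = sizeF a S := (K15.sizeF_eq hS).symm
    rw [h1, ← K15.sizeF_eq T.2.1, hcs] at this
    omega
  refine ⟨⟨Equiv.ofBijective f hf, hprop⟩, ?_⟩
  unfold kaonPoly
  rw [← finsum_set_coe_eq_finsum_mem, ← finsum_set_coe_eq_finsum_mem]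
  symm
  apply finsum_eq_of_bijective f hf
  intro T
  rw [(hprop T).2, (hprop T).1, K15.vmono_eq T.2.1]
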